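/- Let C be a self-orthogonal module over an Artin algebra A such that _CX has a relative injective cogenerator. If D ⊆ _CX is closed under extensions, cokernels of monomorphisms (within _CX), direct summands, and is strongly covariantly finite in _CX (every X∈_CX admits an exact sequence 0→X→D_X→X'→0 with D_X∈D a left D-approximation and X'∈_CX), then for every D∈D there is a short exact sequence 0→D'→W→D→0 with D'∈D and W∈D∩^⊥D. -/

import Mathlib

open CategoryTheory CategoryTheory.Limits Opposite

set_option synthInstance.maxHeartbeats 800000

noncomputable section

universe v u

variable (C : Type u) [Category.{v} C] [Abelian C] [EnoughProjectives C] [EnoughInjectives C]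

/-- The `i`-th Ext group from `X` to `Y` vanishes. -/
def extZero (i : ℕ) (X Y : C) : Prop :=
  Limits.IsZero (((Ext ℤ C i).obj (op X)).obj Y)

variable {C}

/-- A class of objects is self-orthogonal if all positive-degree Ext groups
between its members vanish. -/
def SelfOrth (ω : Set C) : Prop :=
  ∀ W ∈ ω, ∀ W' ∈ ω, ∀ i ≥ 1, extZero C i W W'

/-- The right orthogonal class `ω^⊥`. -/
def rightPerp (ω : Set C) : Set C :=
  {Y | ∀ W ∈ ω, ∀ i ≥ 1, extZero C i W Y}

/-- The left orthogonal class `^⊥ω`. -/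
def leftPerp (ω : Set C) : Set C :=
  {Y | ∀ W ∈ ω, ∀ i ≥ 1, extZero C i Y W}

/-- There exists a short exact sequence `0 → X → Y → Z → 0`. -/
def SES (X Y Z : C) : Prop :=
  ∃ (f : X ⟶ Y) (g : Y ⟶ Z) (w : f ≫ g = 0), (ShortComplex.mk f g w).ShortExact

/-- `coresol ω n` is the class of objects admitting an `ω`-coresolution
`0 → X → W⁰ → ⋯ → Wⁿ → 0` of length `n`. -/
def coresol (ω : Set C) : ℕ → Set C
  | 0 => {X | ∃ W ∈ ω, Nonempty (X ≅ W)}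
  | n + 1 => {X | ∃ W ∈ ω, ∃ X', SES X W X' ∧ X' ∈ coresol ω n}

/-- `check(ω)`: objects with a finite `ω`-coresolution. -/
def checkCat (ω : Set C) : Set C := ⋃ n, coresol ω n

/-- `resol ω n` is the class of objects admitting an `ω`-resolution
`0 → Wₙ → ⋯ → W₀ → X → 0` of length `n`. -/
def resol (ω : Set C) : ℕ → Set C
  | 0 => {X | ∃ W ∈ ω, Nonempty (X ≅ W)}
  | n + 1 => {X | ∃ W ∈ ω, ∃ X', SES X' W X ∧ X' ∈ resol ω n}

/-- `hat(ω)`: objects with a finite `ω`-resolution. -/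
def hatCat (ω : Set C) : Set C := ⋃ n, resol ω n

/-- `_ωX`: objects admitting an exact proper `ω`-resolution
`⋯ → W₁ → W₀ → A → 0` with all syzygies in `ω^⊥`. -/
def omX (ω : Set C) : Set C :=
  {A | ∃ K W : ℕ → C, K 0 = A ∧ (∀ i, W i ∈ ω) ∧
    (∀ i, K (i + 1) ∈ rightPerp ω) ∧ ∀ i, SES (K (i + 1)) (W i) (K i)}

/-- `X_ω`: objects admitting an exact coproper `ω`-coresolution
`0 → A → W⁰ → W¹ → ⋯` with all cosyzygies in `^⊥ω`. -/
def Xom (ω : Set C) : Set C :=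
  {A | ∃ K W : ℕ → C, K 0 = A ∧ (∀ i, W i ∈ ω) ∧
    (∀ i, K (i + 1) ∈ leftPerp ω) ∧ ∀ i, SES (K i) (W i) (K (i + 1))}

/-- `Pres^n_D(ω)`: objects `M` with an exact sequence
`0 → X → Tₙ → ⋯ → T₁ → M → 0`, `Tᵢ ∈ ω`, `X ∈ D`. -/
def Pres (D ω : Set C) : ℕ → Set C
  | 0 => D
  | n + 1 => {M | ∃ T ∈ ω, ∃ X, SES X T M ∧ X ∈ Pres D ω n}

/-- `ω`-codimension: the least length of an `ω`-coresolution. -/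
def codim (ω : Set C) (M : C) : ℕ := sInf {n | M ∈ coresol ω n}

/-- `I` is a relative injective cogenerator of `Y`. -/
def RelInjCogen (I Y : Set C) : Prop :=
  I ⊆ Y ∧ (∀ X ∈ I, ∀ Z ∈ Y, ∀ i ≥ 1, extZero C i Z X) ∧
    ∀ Z ∈ Y, ∃ I₀ ∈ I, ∃ Z', Z' ∈ Y ∧ SES Z I₀ Z'

/-- The direct sum of `n + 1` copies of `T`. -/
def nsum (T : C) : ℕ → C
  | 0 => T
  | n + 1 => T ⊞ nsum T n

/-- `add T`: direct summands of finite direct sums of copies of `T`. -/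
def addOf (T : C) : Set C :=
  {X | ∃ (n : ℕ) (Y : C), Nonempty ((X ⊞ Y) ≅ nsum T n)}


section ArtinAlgebra

variable (R : Type) [CommRing R] [IsArtinianRing R]
variable (A : Type) [Ring A] [Algebra R A] [Module.Finite R A]
variable [Abelian (FGModuleCat A)] [EnoughProjectives (FGModuleCat A)]
variable [EnoughInjectives (FGModuleCat A)]
variable [Limits.HasBinaryBiproducts (FGModuleCat A)]

/-- `M` is a self-orthogonal module: `Ext^i(M, M) = 0` for all `i ≥ 1`. -/
def SelfOrthMod (M : FGModuleCat A) : Prop :=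
  ∀ i ≥ 1, extZero (FGModuleCat A) i M M

/-- `(C, T)` is a tilting pair in `mod A`. -/
def TiltingPair (Cm Tm : FGModuleCat A) : Prop :=
  SelfOrthMod A Cm ∧ SelfOrthMod A Tm ∧
    Tm ∈ hatCat (addOf Cm) ∧ Cm ∈ checkCat (addOf Tm)

/-- `(C, T)` is an `n`-tilting pair: a tilting pair with `add C`-resolution
dimension of `add T` at most `n`. -/
def nTiltingPair (Cm Tm : FGModuleCat A) (n : ℕ) : Prop :=
  TiltingPair A Cm Tm ∧ ∀ X ∈ addOf Tm, X ∈ resol (addOf Cm) n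

end ArtinAlgebra

universe w

section AbelianCategory

variable {𝓐 : Type u} [Category.{v} 𝓐] [Abelian 𝓐]

section ExactSequences

lemma ses_biprod (X Y : 𝓐) : SES X (X ⊞ Y) Y :=
  ⟨biprod.inl, biprod.snd, by simp, (ShortComplex.Splitting.mk (S := .mk _ _ (by simp))
    biprod.fst biprod.inr (by simp) (by simp) (by simp)).shortExact⟩

lemma ses_of_isPullback {D I Z Y P : 𝓐} {i : D ⟶ I} {p : I ⟶ Z} {w : i ≫ p = 0}
    (hS : (ShortComplex.mk i p w).ShortExact) {q : Y ⟶ Z} {a : P ⟶ Y} {b : P ⟶ I}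
    (sq : IsPullback a b q p) : SES D P Y := by
  have := hS.mono_f
  have := hS.epi_g
  have : Mono (sq.lift 0 i (by simp [w])) :=
    mono_of_mono_fac (sq.lift_snd (0 : D ⟶ Y) i (by simp [w]))
  have : Epi a := by
    rw [← sq.isoPullback_hom_fst]
    infer_instance
  refine ⟨sq.lift 0 i (by simp [w]), a, by simp, .mk' ?_ ‹_› ‹_›⟩
  refine ShortComplex.exact_of_f_is_kernel _ (KernelFork.IsLimit.ofι' _ _ fun {A} k hk => ?_)
  refine ⟨hS.exact.lift (k ≫ b) (by simp [← sq.w, reassoc_of% hk]), ?_⟩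
  apply sq.hom_ext
  · simpa using hk.symm
  · simpa using hS.exact.lift_f _ _

lemma ses_of_isPushout {K W D Y P : 𝓐} {i : K ⟶ W} {p : W ⟶ D} {w : i ≫ p = 0}
    (hS : (ShortComplex.mk i p w).ShortExact) {q : K ⟶ Y} {a : Y ⟶ P} {b : W ⟶ P}
    (sq : IsPushout q i a b) : SES Y P D := by
  have := hS.mono_f
  have := hS.epi_g
  have : Epi (sq.desc 0 p (by simp [w])) :=
    epi_of_epi_fac (sq.inr_desc (0 : Y ⟶ D) p (by simp [w]))
  have : Mono a := by
    rw [← sq.inl_isoPushout_inv]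
    infer_instance
  refine ⟨a, sq.desc 0 p (by simp [w]), by simp, .mk' ?_ ‹_› ‹_›⟩
  refine ShortComplex.exact_of_g_is_cokernel _
    (CokernelCofork.IsColimit.ofπ' _ _ fun {A} k hk => ?_)
  refine ⟨hS.exact.desc (b ≫ k) (by simp [← reassoc_of% sq.w, hk]), ?_⟩
  apply sq.hom_ext
  · simpa using hk.symm
  · simpa using hS.exact.g_desc _ _

lemma exists_iso_biprod_of_retract {X Y : 𝓐} (i : X ⟶ Y) (r : Y ⟶ X) (h : i ≫ r = 𝟙 X) :
    ∃ Z : 𝓐, Nonempty (Y ≅ X ⊞ Z) :=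
  have : Mono i := mono_of_mono_fac h
  ⟨cokernel i, ⟨(ShortComplex.Splitting.ofExactOfRetraction
    (ShortComplex.mk i (cokernel.π i) (cokernel.condition i))
    (ShortComplex.exact_cokernel i) r h inferInstance).isoBinaryBiproduct⟩⟩

lemma ses_zero_of_iso {X Y : 𝓐} (e : X ≅ Y) {Z : 𝓐} (hZ : IsZero Z) : SES X Y Z := by
  have : Epi (0 : Y ⟶ Z) := ⟨fun _ _ _ => hZ.eq_of_src _ _⟩
  refine ⟨e.hom, 0, comp_zero, .mk' ?_ inferInstance ‹_›⟩
  exact ((ShortComplex.mk e.hom (0 : Y ⟶ Z) comp_zero).exact_iff_epi rfl).2 inferInstance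

lemma isZero_mem_addOf (T : 𝓐) {Z : 𝓐} (hZ : IsZero Z) : Z ∈ addOf T :=
  ⟨0, T, ⟨(ShortComplex.Splitting.mk (S := .mk (0 : Z ⟶ T) (𝟙 T) (by simp)) 0 (𝟙 T)
    (hZ.eq_of_src _ _) (by simp) (by simp)).isoBinaryBiproduct.symm⟩⟩

end ExactSequences

section ExtVanishing

variable [EnoughProjectives 𝓐]

attribute [local instance] HasExt.standard

/-- Vanishing of the derived functor `Ext` agrees with vanishing of `Abelian.Ext`. -/
lemma extZero_succ_iff (n : ℕ) (X Y : 𝓐) :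
    extZero 𝓐 (n + 1) X Y ↔ ∀ e : Abelian.Ext.{max u v} X Y (n + 1), e = 0 := by
  let P := projectiveResolution X
  have h₁ : extZero 𝓐 (n + 1) X Y ↔ ∀ f : P.complex.X (n + 1) ⟶ Y,
      P.complex.d (n + 2) (n + 1) ≫ f = 0 → ∃ g, P.complex.d (n + 1) n ≫ g = f := by
    unfold extZero
    rw [(P.isoExt (R := ℤ) (n + 1) Y).isZero_iff,
      ← HomologicalComplex.exactAt_iff_isZero_homology,
      HomologicalComplex.exactAt_iff' _ n (n + 1) (n + 2) (by simp) (by simp),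
      ShortComplex.moduleCat_exact_iff]
    rfl
  rw [h₁]
  constructor
  · intro h e
    obtain ⟨f, hf, rfl⟩ := P.extMk_surjective e (n + 2) rfl
    exact (P.extMk_eq_zero_iff f (n + 2) rfl hf n rfl).2 (h f hf)
  · intro h f hf
    exact (P.extMk_eq_zero_iff f (n + 2) rfl hf n rfl).1 (h _)

lemma extZero_iff {n : ℕ} (hn : n ≥ 1) (X Y : 𝓐) :
    extZero 𝓐 n X Y ↔ ∀ e : Abelian.Ext.{max u v} X Y n, e = 0 := by
  obtain ⟨n, rfl⟩ := Nat.exists_eq_add_of_le' hn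
  exact extZero_succ_iff n X Y

lemma extZero_of_retract_left {n : ℕ} (hn : n ≥ 1) {X X' Y : 𝓐} (i : X ⟶ X') (r : X' ⟶ X)
    (h : i ≫ r = 𝟙 X) (hX' : extZero 𝓐 n X' Y) : extZero 𝓐 n X Y := by
  rw [extZero_iff hn] at *
  intro e
  rw [← Abelian.Ext.mk₀_id_comp e, ← h, ← Abelian.Ext.mk₀_comp_mk₀_assoc,
    hX' ((Abelian.Ext.mk₀ r).comp e (zero_add n)), Abelian.Ext.comp_zero]

lemma extZero_of_retract_right {n : ℕ} (hn : n ≥ 1) {X Y Y' : 𝓐} (i : Y ⟶ Y') (r : Y' ⟶ Y)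
    (h : i ≫ r = 𝟙 Y) (hY' : extZero 𝓐 n X Y') : extZero 𝓐 n X Y := by
  rw [extZero_iff hn] at *
  intro e
  rw [← Abelian.Ext.comp_mk₀_id e, ← h, ← Abelian.Ext.mk₀_comp_mk₀,
    ← Abelian.Ext.comp_assoc_of_third_deg_zero, hY' (e.comp _ (add_zero n)),
    Abelian.Ext.zero_comp]

lemma extZero_of_isZero_right {n : ℕ} (hn : n ≥ 1) {X Y : 𝓐} (hY : IsZero Y) :
    extZero 𝓐 n X Y := by
  rw [extZero_iff hn]
  intro e
  rw [← Abelian.Ext.comp_mk₀_id e, hY.eq_of_src (𝟙 Y) 0, Abelian.Ext.mk₀_zero,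
    Abelian.Ext.comp_zero]

lemma extZero_left_middle {n : ℕ} (hn : n ≥ 1) {X₁ X₂ X₃ Y : 𝓐} (h : SES X₁ X₂ X₃)
    (h₁ : extZero 𝓐 n X₁ Y) (h₃ : extZero 𝓐 n X₃ Y) : extZero 𝓐 n X₂ Y := by
  rw [extZero_iff hn] at *
  obtain ⟨f, g, w, hS⟩ := h
  intro e
  obtain ⟨e', rfl⟩ := Abelian.Ext.contravariant_sequence_exact₂ hS _ e (h₁ _)
  rw [h₃ e', Abelian.Ext.comp_zero]

lemma extZero_right_middle {n : ℕ} (hn : n ≥ 1) {X Y₁ Y₂ Y₃ : 𝓐} (h : SES Y₁ Y₂ Y₃)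
    (h₁ : extZero 𝓐 n X Y₁) (h₃ : extZero 𝓐 n X Y₃) : extZero 𝓐 n X Y₂ := by
  rw [extZero_iff hn] at *
  obtain ⟨f, g, w, hS⟩ := h
  intro e
  obtain ⟨e', rfl⟩ := Abelian.Ext.covariant_sequence_exact₂ _ hS e (h₃ _)
  rw [h₁ e', Abelian.Ext.zero_comp]

lemma extZero_right_last {n : ℕ} (hn : n ≥ 1) {X Y₁ Y₂ Y₃ : 𝓐} (h : SES Y₁ Y₂ Y₃)
    (h₁ : extZero 𝓐 (n + 1) X Y₁) (h₂ : extZero 𝓐 n X Y₂) : extZero 𝓐 n X Y₃ := by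
  rw [extZero_iff hn] at *
  rw [extZero_succ_iff] at h₁
  obtain ⟨f, g, w, hS⟩ := h
  intro e
  obtain ⟨e', rfl⟩ := Abelian.Ext.covariant_sequence_exact₃ _ hS e rfl (h₁ _)
  rw [h₂ e', Abelian.Ext.zero_comp]

lemma extZero_right_first {n : ℕ} (hn : n ≥ 1) {X Y₁ Y₂ Y₃ : 𝓐} (h : SES Y₁ Y₂ Y₃)
    (h₂ : extZero 𝓐 (n + 1) X Y₂) (h₃ : extZero 𝓐 n X Y₃) : extZero 𝓐 (n + 1) X Y₁ := by
  rw [extZero_iff hn] at *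
  rw [extZero_succ_iff] at *
  obtain ⟨f, g, w, hS⟩ := h
  intro e
  obtain ⟨e', rfl⟩ := Abelian.Ext.covariant_sequence_exact₁ _ hS e (h₂ _) rfl
  rw [h₃ e', Abelian.Ext.zero_comp]

/-- `Ext¹(X, Y₁) = 0` as soon as `Ext¹(X, Y₂) = 0` and every `X ⟶ Y₃` lifts to `Y₂`. -/
lemma extZero_one_of_lift {X : 𝓐} {S : ShortComplex 𝓐} (hS : S.ShortExact)
    (h₂ : extZero 𝓐 1 X S.X₂) (h₃ : ∀ q : X ⟶ S.X₃, ∃ t, t ≫ S.g = q) :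
    extZero 𝓐 1 X S.X₁ := by
  rw [extZero_iff le_rfl] at *
  intro e
  obtain ⟨e', rfl⟩ := Abelian.Ext.covariant_sequence_exact₁ _ hS e (h₂ _) rfl
  obtain ⟨q, rfl⟩ := (Abelian.Ext.mk₀_bijective _ _).2 e'
  obtain ⟨t, rfl⟩ := h₃ q
  rw [← Abelian.Ext.mk₀_comp_mk₀, Abelian.Ext.comp_assoc_of_second_deg_zero, hS.comp_extClass,
    Abelian.Ext.comp_zero]

lemma exists_retraction_of_extZero {S : ShortComplex 𝓐} (hS : S.ShortExact)
    (h : extZero 𝓐 1 S.X₃ S.X₁) : ∃ r, S.f ≫ r = 𝟙 S.X₁ := by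
  rw [extZero_iff le_rfl] at h
  obtain ⟨e, he⟩ := Abelian.Ext.contravariant_sequence_exact₁ hS S.X₁
    (Abelian.Ext.mk₀ (𝟙 S.X₁)) rfl (h _)
  obtain ⟨r, rfl⟩ := (Abelian.Ext.mk₀_bijective _ _).2 e
  rw [Abelian.Ext.mk₀_comp_mk₀] at he
  exact ⟨r, (Abelian.Ext.mk₀_bijective _ _).1 he⟩

lemma extZero_of_mem_addOf_left {n : ℕ} (hn : n ≥ 1) {T X Y : 𝓐} (hX : X ∈ addOf T)
    (h : extZero 𝓐 n T Y) : extZero 𝓐 n X Y := by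
  obtain ⟨m, Z, ⟨e⟩⟩ := hX
  have hm (m : ℕ) : extZero 𝓐 n (nsum T m) Y := by
    induction m with
    | zero => exact h
    | succ m ih => exact extZero_left_middle hn (ses_biprod _ _) h ih
  exact extZero_of_retract_left hn (biprod.inl ≫ e.hom) (e.inv ≫ biprod.fst) (by simp) (hm m)

lemma extZero_of_mem_addOf_right {n : ℕ} (hn : n ≥ 1) {T X Y : 𝓐} (hY : Y ∈ addOf T)
    (h : extZero 𝓐 n X T) : extZero 𝓐 n X Y := by
  obtain ⟨m, Z, ⟨e⟩⟩ := hY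
  have hm (m : ℕ) : extZero 𝓐 n X (nsum T m) := by
    induction m with
    | zero => exact h
    | succ m ih => exact extZero_right_middle hn (ses_biprod _ _) h ih
  exact extZero_of_retract_right hn (biprod.inl ≫ e.hom) (e.inv ≫ biprod.fst) (by simp) (hm m)

lemma selfOrth_addOf {T : 𝓐} (h : ∀ i ≥ 1, extZero 𝓐 i T T) : SelfOrth (addOf T) :=
  fun _ hW _ hW' i hi =>
    extZero_of_mem_addOf_left hi hW (extZero_of_mem_addOf_right hi hW' (h i hi))

end ExtVanishing


section RelativeCotorsion

variable [EnoughProjectives 𝓐]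

/-- Wakamatsu's lemma, relative to the middle term of an extension of `D`-objects. -/
lemma extZero_one_of_minimal_approx {D : Set 𝓐}
    (hext : ∀ X Y Z : 𝓐, SES X Y Z → X ∈ D → Z ∈ D → Y ∈ D)
    {S : ShortComplex 𝓐} (hS : S.ShortExact) (hSD : S.X₂ ∈ D)
    (happ : ∀ D' ∈ D, ∀ u : S.X₁ ⟶ D', ∃ v, S.f ≫ v = u)
    (hmin : ∀ φ : S.X₂ ⟶ S.X₂, S.f ≫ φ = S.f → IsIso φ)
    {T : ShortComplex 𝓐} (hT : T.ShortExact) (hTD : T.X₁ ∈ D)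
    (h : extZero 𝓐 1 S.X₃ T.X₂) : extZero 𝓐 1 S.X₃ T.X₁ := by
  refine extZero_one_of_lift hT h fun q => ?_
  have := hS.epi_g
  obtain ⟨s, hs⟩ := happ _
    (hext _ _ _ (ses_of_isPullback hT (IsPullback.of_hasPullback (S.g ≫ q) T.g)) hTD hSD)
    (pullback.lift S.f 0 (by simp))
  have hs₁ : S.f ≫ s ≫ pullback.fst _ _ = S.f := by
    rw [reassoc_of% hs]
    exact pullback.lift_fst _ _ _
  have hs₂ : S.f ≫ s ≫ pullback.snd _ _ = 0 := by
    rw [reassoc_of% hs]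
    exact pullback.lift_snd _ _ _
  have := hmin _ hs₁
  have hinv : S.f ≫ inv (s ≫ pullback.fst (S.g ≫ q) T.g) = S.f := by
    rw [IsIso.comp_inv_eq, hs₁]
  refine ⟨hS.exact.desc (inv (s ≫ pullback.fst (S.g ≫ q) T.g) ≫ s ≫ pullback.snd _ _)
    (by rw [reassoc_of% hinv, hs₂]), ?_⟩
  rw [← cancel_epi S.g, hS.exact.g_desc_assoc, Category.assoc, Category.assoc,
    ← pullback.condition, IsIso.inv_comp_eq, Category.assoc]

lemma isZero_mem_omX (ω : Set 𝓐) {Z : 𝓐} (hZ : IsZero Z) (hω : Z ∈ ω) : Z ∈ omX ω :=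
  ⟨fun _ => Z, fun _ => Z, rfl, fun _ => hω,
    fun _ _ _ _ hi => extZero_of_isZero_right hi hZ, fun _ => ses_zero_of_iso (Iso.refl Z) hZ⟩

lemma omX_subset_rightPerp {ω : Set 𝓐} (hω : SelfOrth ω) : omX ω ⊆ rightPerp ω := by
  rintro _ ⟨K, W, rfl, hW, hK, h⟩ V hV i hi
  exact extZero_right_last hi (h 0) (hK 0 V hV (i + 1) (by lia)) (hω V hV _ (hW 0) i hi)

lemma exists_ses_of_mem_omX {ω : Set 𝓐} {X : 𝓐} (hX : X ∈ omX ω) :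
    ∃ K ∈ omX ω, ∃ W ∈ ω, SES K W X := by
  obtain ⟨K, W, rfl, hW, hK, h⟩ := hX
  exact ⟨K 1, ⟨fun i => K (i + 1), fun i => W (i + 1), rfl, fun i => hW _, fun i => hK _,
    fun i => h _⟩, W 0, hW 0, h 0⟩

/-- Every morphism has a left minimal version. -/
def HasLeftMinimalVersions (𝓑 : Type*) [Category* 𝓑] : Prop :=
  ∀ ⦃X Y : 𝓑⦄ (f : X ⟶ Y), ∃ (Y₁ : 𝓑) (ι : Y₁ ⟶ Y) (π : Y ⟶ Y₁), ι ≫ π = 𝟙 Y₁ ∧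
    f ≫ π ≫ ι = f ∧ ∀ φ : Y₁ ⟶ Y₁, f ≫ π ≫ φ = f ≫ π → IsIso φ

theorem exists_ses_of_stronglyCovariantlyFinite {z : HasZeroMorphisms 𝓐}
    [HasBinaryBiproducts 𝓐] (hleft : HasLeftMinimalVersions 𝓐)
    (Cm : 𝓐) (hC : ∀ i ≥ 1, extZero 𝓐 i Cm Cm)
    (I : Set 𝓐) (hI : RelInjCogen I (omX (addOf Cm)))
    (D : Set 𝓐) (hDsub : D ⊆ omX (addOf Cm))
    (hext : ∀ X Y Z : 𝓐, SES X Y Z → X ∈ D → Z ∈ D → Y ∈ D)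
    (hcok : ∀ X Y Z : 𝓐, SES X Y Z → X ∈ D → Y ∈ D → Z ∈ omX (addOf Cm) → Z ∈ D)
    (hsum : ∀ X Y : 𝓐, (@biprod 𝓐 _ z X Y _) ∈ D → X ∈ D)
    (hcov : ∀ X ∈ omX (addOf Cm),
      ∃ (DX X' : 𝓐) (f : X ⟶ DX) (g : DX ⟶ X') (w : f ≫ g = @Zero.zero _ (z.zero X X')),
        DX ∈ D ∧ X' ∈ omX (addOf Cm) ∧ (@ShortComplex.mk _ _ z _ _ _ f g w).ShortExact ∧
          ∀ D' ∈ D, ∀ u : X ⟶ D', ∃ v : DX ⟶ D', f ≫ v = u) :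
    ∀ D₀ ∈ D, ∃ D' ∈ D, ∃ W, W ∈ D ∧ W ∈ leftPerp D ∧ SES D' W D₀ := by
  obtain rfl : z = Preadditive.preadditiveHasZeroMorphisms := Subsingleton.elim _ _
  intro D₀ hD₀
  have hperp := omX_subset_rightPerp (selfOrth_addOf hC)
  have hzero {Z : 𝓐} (hZ : IsZero Z) : Z ∈ D :=
    hcok _ _ _ (ses_zero_of_iso (Iso.refl D₀) hZ) hD₀ hD₀
      (isZero_mem_omX _ hZ (isZero_mem_addOf Cm hZ))
  have hiso {X Y : 𝓐} (e : X ≅ Y) (hX : X ∈ D) : Y ∈ D :=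
    hext _ _ _ (ses_zero_of_iso e (isZero_zero 𝓐)) hX (hzero (isZero_zero 𝓐))
  have hretract {X Y : 𝓐} (i : X ⟶ Y) (r : Y ⟶ X) (h : i ≫ r = 𝟙 X) (hY : Y ∈ D) : X ∈ D := by
    obtain ⟨Z, ⟨e⟩⟩ := exists_iso_biprod_of_retract i r h
    exact hsum X Z (hiso e hY)
  obtain ⟨hIsub, hIinj, hIcogen⟩ := hI
  have hID : I ⊆ D := by
    intro X hX
    obtain ⟨DX, X', f, g, w, hDX, hX', hS, -⟩ := hcov X (hIsub hX)
    obtain ⟨r, hr⟩ := exists_retraction_of_extZero hS (hIinj X hX X' hX' 1 le_rfl)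
    exact hretract f r hr hDX
  have hDI (D' : 𝓐) (hD' : D' ∈ D) : ∃ J ∈ I, ∃ Z ∈ D, SES D' J Z := by
    obtain ⟨J, hJ, Z, hZ, h⟩ := hIcogen D' (hDsub hD')
    exact ⟨J, hJ, Z, hcok _ _ _ h hD' (hID hJ) hZ, h⟩
  obtain ⟨K, hK, W₀, hW₀, i, p, w, hres⟩ := exists_ses_of_mem_omX (hDsub hD₀)
  obtain ⟨DK, K', f, g, wfg, hDK, hK', hS, happ⟩ := hcov K hK
  have wfg' : f ≫ g = 0 := wfg
  obtain ⟨Y, ι, π, hιπ, hfπ, hmin⟩ := hleft f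
  have := hS.mono_f
  have hYD : Y ∈ D := hretract ι π hιπ hDK
  let f' := f ≫ π
  have : Mono f' := mono_of_mono_fac (show f' ≫ ι = f by simpa [f'] using hfπ)
  let S : ShortComplex 𝓐 := ShortComplex.mk f' (cokernel.π f') (cokernel.condition f')
  have hS' : S.ShortExact := .mk' (ShortComplex.exact_cokernel f') ‹_› inferInstance
  -- The cokernel of the minimal approximation is a retract of `K'`.
  have := hS.epi_g
  obtain ⟨j, hj⟩ : ∃ j : cokernel f' ⟶ K', cokernel.π f' ≫ j = ι ≫ g :=
    ⟨cokernel.desc f' (ι ≫ g) (by simp [f', reassoc_of% hfπ, wfg']), by simp⟩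
  obtain ⟨r, hr⟩ : ∃ r : K' ⟶ cokernel f', g ≫ r = π ≫ cokernel.π f' :=
    ⟨hS.exact.desc (π ≫ cokernel.π f')
      (by rw [← Category.assoc]; exact cokernel.condition f'), hS.exact.g_desc _ _⟩
  have hjr : j ≫ r = 𝟙 _ := by
    rw [← cancel_epi (cokernel.π f'), reassoc_of% hj, hr, reassoc_of% hιπ, Category.comp_id]
  have hinj (J : 𝓐) (hJ : J ∈ I) (n : ℕ) (hn : n ≥ 1) : extZero 𝓐 n (cokernel f') J :=
    extZero_of_retract_left hn j r hjr (hIinj J hJ K' hK' n hn)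
  have hcoker (n : ℕ) : ∀ D' ∈ D, extZero 𝓐 (n + 1) (cokernel f') D' := by
    induction n with
    | zero =>
      intro D' hD'
      obtain ⟨J, hJ, Z, -, i, p, w, hT⟩ := hDI D' hD'
      refine extZero_one_of_minimal_approx hext hS' hYD (fun E hE u => ?_) (fun φ hφ => ?_)
        hT hD' (hinj J hJ 1 le_rfl)
      · obtain ⟨v, rfl⟩ := happ E hE u
        exact ⟨ι ≫ v, by simp [S, f', reassoc_of% hfπ]⟩
      · exact hmin φ (by simpa [S, f'] using hφ)
    | succ n ih =>
      intro D' hD'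
      obtain ⟨J, hJ, Z, hZ, hT⟩ := hDI D' hD'
      exact extZero_right_first (by lia) hT (hinj J hJ _ (by lia)) (ih Z hZ)
  have sq := IsPushout.of_hasPushout f' i
  have hYW := ses_of_isPushout hres sq
  have hWW := ses_of_isPushout hS' sq.flip
  refine ⟨Y, hYD, _, hext _ _ _ hYW hYD hD₀, fun D' hD' n hn => ?_, hYW⟩
  obtain ⟨n, rfl⟩ := Nat.exists_eq_add_of_le' hn
  exact extZero_left_middle hn hWW (hperp (hDsub hD') W₀ hW₀ _ hn) (hcoker n D' hD')

end RelativeCotorsion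

end AbelianCategory


section FinitelyGenerated

variable {A : Type} [Ring A]

/-- The morphism from the regular module that picks out an element. -/
def FGModuleCat.ofElement {X : FGModuleCat.{v} A} (m : X) :
    FGModuleCat.of A (ULift.{v} A) ⟶ X :=
  FGModuleCat.ofHom ((LinearMap.toSpanSingleton A X m).comp ULift.moduleEquiv.toLinearMap)

lemma FGModuleCat.ofElement_apply {X : FGModuleCat.{v} A} (m : X) (a : ULift.{v} A) :
    (ofElement m).hom.hom a = a.down • m := rfl

lemma FGModuleCat.injective_of_mono {X Y : FGModuleCat.{v} A} (f : X ⟶ Y) [Mono f] :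
    Function.Injective f.hom.hom := by
  intro x y hxy
  have hg : ofElement x = ofElement y := by
    rw [← cancel_mono f]
    ext a
    change f.hom.hom (a.down • x) = f.hom.hom (a.down • y)
    rw [map_smul, map_smul, hxy]
  have := congr(($hg).hom.hom ⟨1⟩)
  rwa [ofElement_apply, ofElement_apply, one_smul, one_smul] at this

lemma FGModuleCat.mono_of_injective {X Y : FGModuleCat.{v} A} (f : X ⟶ Y)
    (hf : Function.Injective f.hom.hom) : Mono f :=
  ⟨fun g h w => by
    ext x
    exact hf congr(($w).hom.hom x)⟩

/-- The kernel of `A ⟶ A ⧸ N` among finitely generated modules surjects onto the left ideal `N`. -/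
lemma isNoetherianRing_of_hasKernels [HasKernels (FGModuleCat.{v} A)] :
    IsNoetherianRing A := by
  refine isNoetherianRing_iff.2 ⟨fun N => ?_⟩
  let q : FGModuleCat.of A (ULift.{v} A) ⟶ FGModuleCat.of A (ULift.{v} (A ⧸ N)) :=
    FGModuleCat.ofHom
      (ULift.moduleEquiv.symm.toLinearMap ∘ₗ N.mkQ ∘ₗ ULift.moduleEquiv.toLinearMap)
  have hq (a : ULift.{v} A) : q.hom.hom a = 0 ↔ a.down ∈ N := by
    rw [← Submodule.Quotient.mk_eq_zero]
    exact ULift.moduleEquiv.symm.map_eq_zero_iff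
  let j : (kernel q).carrier →ₗ[A] A := ULift.moduleEquiv.toLinearMap ∘ₗ (kernel.ι q).hom.hom
  suffices N = LinearMap.range j from this ▸ Module.Finite.iff_fg.1 inferInstance
  apply le_antisymm
  · intro n hn
    have hw : FGModuleCat.ofElement (X := FGModuleCat.of A (ULift.{v} A)) ⟨n⟩ ≫ q = 0 := by
      ext a
      exact congrArg ULift.down ((hq _).2 (N.smul_mem a.down hn))
    refine ⟨(kernel.lift q _ hw).hom.hom ⟨1⟩, ?_⟩
    have := congr((($(kernel.lift_ι q _ hw)).hom.hom ⟨1⟩).down)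
    exact this.trans (one_smul A n)
  · rintro _ ⟨k, rfl⟩
    exact (hq _).1 congr(($(kernel.condition q)).hom.hom k)

/-- Finitely generated modules embed in finitely generated modules that are injective for
finitely generated modules, in whatever universe the latter are assumed to live. -/
lemma exists_injective_fg [EnoughInjectives (FGModuleCat.{w} A)] (M : Type v) [AddCommGroup M]
    [Module A M] [Module.Finite A M] :
    ∃ (E : FGModuleCat.{w} A) (i : M →ₗ[A] E), Function.Injective i ∧
      ∀ g : M →ₗ[A] E, Function.Injective g → ∃ ψ : E →ₗ[A] E, ψ ∘ₗ g = i := by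
  obtain ⟨n, f, hf⟩ := Module.Finite.exists_fin' A M
  let M' := FGModuleCat.of A (ULift.{w} ((Fin n → A) ⧸ LinearMap.ker f))
  let e : M' ≃ₗ[A] M := ULift.moduleEquiv.trans (f.quotKerEquivOfSurjective hf)
  refine ⟨Injective.under M', (Injective.ι M').hom.hom ∘ₗ e.symm.toLinearMap,
    (FGModuleCat.injective_of_mono (Injective.ι M')).comp e.symm.injective, fun g hg => ?_⟩
  let g' : M' ⟶ Injective.under M' := ObjectProperty.homMk (ModuleCat.ofHom (g ∘ₗ e.toLinearMap))
  have : Mono g' := FGModuleCat.mono_of_injective g' (hg.comp e.injective)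
  refine ⟨(Injective.factorThru (Injective.ι M') g').hom.hom, ?_⟩
  ext m
  have h : (Injective.factorThru (Injective.ι M') g').hom.hom (g (e (e.symm m))) =
      (Injective.ι M').hom.hom (e.symm m) :=
    congr(($(Injective.comp_factorThru (Injective.ι M') g')).hom.hom (e.symm m))
  rwa [e.apply_symm_apply] at h

/-- Over a noetherian ring whose finitely generated modules have enough injectives, injective
endomorphisms of finitely generated modules are surjective. -/
lemma surjective_of_injective_fg [IsNoetherianRing A] [EnoughInjectives (FGModuleCat.{w} A)]
    (M : FGModuleCat.{v} A) (φ : M →ₗ[A] M) (hφ : Function.Injective φ) :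
    Function.Surjective φ := by
  obtain ⟨E, i, hi, hE⟩ := exists_injective_fg.{v, w} (A := A) M
  obtain ⟨ψ, hψ⟩ := hE (i ∘ₗ φ) (hi.comp hφ)
  replace hψ (y : M) : ψ (i (φ y)) = i y := LinearMap.congr_fun hψ y
  have hpow (n : ℕ) (y : M) : (ψ ^ n) (i ((φ ^ n) y)) = i y := by
    induction n generalizing y with
    | zero => rfl
    | succ n ih => rw [pow_succ ψ, pow_succ' φ, Module.End.mul_apply, Module.End.mul_apply, hψ, ih]
  obtain ⟨N, hN⟩ := monotone_stabilizes_iff_noetherian.2 (inferInstanceAs (IsNoetherian A E))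
    ψ.iterateKer
  have hshift (n : ℕ) (y : M) :
      (ψ ^ (n + 1)) (i ((φ ^ N) (φ y))) = (ψ ^ n) (i ((φ ^ N) y)) := by
    rw [← Module.End.mul_apply (φ ^ N), ← pow_succ, pow_succ' φ, pow_succ ψ,
      Module.End.mul_apply, Module.End.mul_apply, hψ]
  let U : ℕ →o Submodule A E := ⟨fun n =>
      LinearMap.range ((ψ ^ n : E →ₗ[A] E) ∘ₗ i ∘ₗ (φ ^ N : M →ₗ[A] M)),
    monotone_nat_of_le_succ fun n => by
      rintro _ ⟨y, rfl⟩
      exact ⟨φ y, hshift n y⟩⟩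
  obtain ⟨n, hn⟩ := monotone_stabilizes_iff_noetherian.2 (inferInstanceAs (IsNoetherian A E)) U
  intro y
  obtain ⟨y', hy'⟩ : (ψ ^ (n + 1)) (i ((φ ^ N) y)) ∈ U n := by
    rw [hn (n + 1) (by lia)]
    exact ⟨y, rfl⟩
  replace hy' : (ψ ^ n) (i ((φ ^ N) y')) = (ψ ^ (n + 1)) (i ((φ ^ N) y)) := hy'
  have hker : i ((φ ^ N) (φ y' - y)) ∈ LinearMap.ker (ψ ^ (n + 1)) := by
    simp only [LinearMap.mem_ker, map_sub, hshift, hy', sub_self]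
  have hker' : i ((φ ^ N) (φ y' - y)) ∈ LinearMap.ker (ψ ^ N) := by
    have := ψ.iterateKer.monotone (le_max_right N (n + 1)) hker
    rwa [← hN _ (le_max_left N (n + 1))] at this
  rw [LinearMap.mem_ker, hpow] at hker'
  exact ⟨y', sub_eq_zero.1 (hi (hker'.trans (map_zero i).symm))⟩

lemma hasLeftMinimalVersions_fg [IsNoetherianRing A]
    (h : ∀ (Y : FGModuleCat.{v} A) (φ : Y →ₗ[A] Y), Function.Injective φ → Function.Surjective φ) :
    HasLeftMinimalVersions (FGModuleCat.{v} A) := by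
  intro X Y f
  let s : Set (Submodule A Y) := {K | ∃ e : Y ⟶ Y, f ≫ e = f ∧ LinearMap.ker e.hom.hom = K}
  obtain ⟨_, ⟨e, he, rfl⟩, hmax⟩ := wellFounded_gt.has_min s ⟨_, 𝟙 Y, by simp, rfl⟩
  replace hmax (e' : Y ⟶ Y) (he' : f ≫ e' = f)
      (hle : LinearMap.ker e.hom.hom ≤ LinearMap.ker e'.hom.hom) :
      LinearMap.ker e'.hom.hom ≤ LinearMap.ker e.hom.hom := by
    by_contra hlt
    exact hmax _ ⟨e', he', rfl⟩ (lt_of_le_not_ge hle hlt)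
  let ε := e.hom.hom.rangeRestrict ∘ₗ (LinearMap.range e.hom.hom).subtype
  have hε : Function.Injective ε := by
    rw [injective_iff_map_eq_zero]
    rintro ⟨_, y, rfl⟩ hy
    have hee : f ≫ e ≫ e = f := by rw [reassoc_of% he, he]
    have hy' : e.hom.hom (e.hom.hom y) = 0 := congr(($hy).1)
    exact Subtype.ext (hmax (e ≫ e) hee (LinearMap.ker_le_ker_comp _ _) hy')
  let Y₁ : FGModuleCat A := FGModuleCat.of A (LinearMap.range e.hom.hom)
  let ε' : Y₁ ≃ₗ[A] Y₁ := LinearEquiv.ofBijective ε ⟨hε, h Y₁ ε hε⟩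
  let π₀ : Y →ₗ[A] Y₁ := ε'.symm.toLinearMap ∘ₗ e.hom.hom.rangeRestrict
  let ι : Y₁ ⟶ Y := ObjectProperty.homMk (ModuleCat.ofHom (LinearMap.range e.hom.hom).subtype)
  let π : Y ⟶ Y₁ := ObjectProperty.homMk (ModuleCat.ofHom π₀)
  have hιπ : ι ≫ π = 𝟙 Y₁ := by
    ext y
    exact congrArg Subtype.val (ε'.symm_apply_apply y)
  have hπ_of_ker (z : Y) (hz : e.hom.hom z = 0) : π.hom.hom z = 0 :=
    (congrArg ε'.symm (show e.hom.hom.rangeRestrict z = 0 from Subtype.ext hz)).trans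
      (map_zero ε'.symm)
  have hf (x : X) : e.hom.hom (f.hom.hom x) = f.hom.hom x := congr(($he).hom.hom x)
  have hfπ : f ≫ π ≫ ι = f := by
    ext x
    have : π₀ (f.hom.hom x) = ⟨f.hom.hom x, f.hom.hom x, hf x⟩ := by
      rw [LinearMap.comp_apply]
      refine ε'.symm_apply_eq.2 (Subtype.ext ?_)
      rfl
    exact congr(($this).1)
  refine ⟨Y₁, ι, π, hιπ, hfπ, fun φ hφ => ?_⟩
  have hφinj : Function.Injective φ.hom.hom := by
    rw [injective_iff_map_eq_zero]
    intro y hy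
    have hπι : π.hom.hom (ι.hom.hom y) = y := congr(($hιπ).hom.hom y)
    have hle : LinearMap.ker e.hom.hom ≤ LinearMap.ker (π ≫ φ ≫ ι).hom.hom := by
      intro z hz
      have : π.hom.hom z = 0 := hπ_of_ker z hz
      change ι.hom.hom (φ.hom.hom (π.hom.hom z)) = 0
      rw [this, map_zero, map_zero]
    have := hmax (π ≫ φ ≫ ι) (by rw [reassoc_of% hφ, hfπ]) hle
      (show ι.hom.hom y ∈ _ from by
        change ι.hom.hom (φ.hom.hom (π.hom.hom (ι.hom.hom y))) = 0
        rw [hπι, hy, map_zero])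
    rw [← hπι]
    exact hπ_of_ker _ this
  let φ' := LinearEquiv.ofBijective φ.hom.hom ⟨hφinj, h Y₁ _ hφinj⟩
  refine ⟨ObjectProperty.homMk (ModuleCat.ofHom φ'.symm.toLinearMap), ?_, ?_⟩
  · ext y
    exact congrArg Subtype.val (φ'.symm_apply_apply y)
  · ext y
    exact congrArg Subtype.val (φ'.apply_symm_apply y)

end FinitelyGenerated


section ArtinAlgebra

variable {R : Type} [CommRing R] [IsArtinianRing R]
variable {A : Type} [Ring A] [Algebra R A] [Module.Finite R A]
variable [Abelian (FGModuleCat A)] [EnoughProjectives (FGModuleCat A)]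
variable [EnoughInjectives (FGModuleCat A)]
variable [Limits.HasBinaryBiproducts (FGModuleCat A)]

theorem stmt16 (Cm : FGModuleCat A) (hC : SelfOrthMod A Cm)
    (I : Set (FGModuleCat A)) (hI : RelInjCogen I (omX (addOf Cm)))
    (D : Set (FGModuleCat A)) (hDsub : D ⊆ omX (addOf Cm))
    (hext : ∀ X Y Z : FGModuleCat A, SES X Y Z → X ∈ D → Z ∈ D → Y ∈ D)
    (hcok : ∀ X Y Z : FGModuleCat A, SES X Y Z → X ∈ D → Y ∈ D →
      Z ∈ omX (addOf Cm) → Z ∈ D)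
    (hsum : ∀ X Y : FGModuleCat A, (X ⊞ Y) ∈ D → X ∈ D)
    (hcov : ∀ X ∈ omX (addOf Cm),
      ∃ (DX X' : FGModuleCat A) (f : X ⟶ DX) (g : DX ⟶ X') (w : f ≫ g = 0),
        DX ∈ D ∧ X' ∈ omX (addOf Cm) ∧ (ShortComplex.mk f g w).ShortExact ∧
          ∀ D' ∈ D, ∀ u : X ⟶ D', ∃ v : DX ⟶ D', f ≫ v = u) :
    ∀ D₀ ∈ D, ∃ D' ∈ D, ∃ W, W ∈ D ∧ W ∈ leftPerp D ∧ SES D' W D₀ := by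
  have : IsNoetherianRing A := isNoetherianRing_of_hasKernels
  exact exists_ses_of_stronglyCovariantlyFinite
    (hasLeftMinimalVersions_fg surjective_of_injective_fg) Cm hC I hI D hDsub hext hcok hsum hcov

end ArtinAlgebra
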